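/- Let r ≥ 3 and let E ⊆ GF(2)^r \ {0} be fano-free with |E| > (5/8)·2^r, and suppose every linear hyperplane of GF(2)^r contains a triangle of E (three nonzero vectors x, y, x+y all in E). Then for every p ∈ E, the cone E_p = {x ∈ E : x ≠ p, x + p ∈ E} satisfies |E_p| ≤ (5/16)·2^r. -/

import Mathlib

open Finset in
theorem clebsch_point {V : Type*} [AddCommGroup V] [Module (ZMod 2) V] [DecidableEq V]
    (h2 : ∀ x : V, x + x = 0) (A : Finset V)
    (hsf : ∀ x y, x ∈ A → y ∈ A → x + y ∉ A)
    (a b c d : V) (ha : a ∈ A) (hb : b ∈ A) (hc : c ∈ A) (hd : d ∈ A)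
    (he : a + b + c + d ∈ A) (v : V) (hv : v ∈ A) :
    (∑ q : ZMod 2 × ZMod 2 × ZMod 2 × ZMod 2,
      if v + (q.1 • a + (q.2.1 • b + (q.2.2.1 • c + q.2.2.2 • d))) ∈ A then 1 else 0) ≤ 5 := by
  obtain ⟨I, hI⟩ : ∃ I : V → ℕ, I = fun x => if x ∈ A then 1 else 0 := ⟨_, rfl⟩
  have key : ∀ x y, x + y ∈ A → I x + I y ≤ 1 := by
    intro x y h
    subst hI
    by_cases hx : x ∈ A <;> by_cases hy : y ∈ A <;> simp [hx, hy]
    exact hsf x y hx hy h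
  have hIv : I v = 1 := by subst hI; simp [hv]
  have e : (∑ q : ZMod 2 × ZMod 2 × ZMod 2 × ZMod 2,
      if v + (q.1 • a + (q.2.1 • b + (q.2.2.1 • c + q.2.2.2 • d))) ∈ A then 1 else 0)
      = ∑ q : ZMod 2 × ZMod 2 × ZMod 2 × ZMod 2,
        I (v + (q.1 • a + (q.2.1 • b + (q.2.2.1 • c + q.2.2.2 • d)))) := by subst hI; rfl
  have hs : ∀ g : ZMod 2 → ℕ, ∑ i, g i = g 0 + g 1 := fun g => Fin.sum_univ_two g
  rw [e]
  simp only [Fintype.sum_prod_type, hs, zero_smul, one_smul, add_zero, zero_add]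
  have k : ∀ x y z, z ∈ A → x + y = z → I x + I y ≤ 1 := by
    intro x y z hz h; exact key x y (h ▸ hz)
  have n1 := k v (v + a) a ha (by grind)
  have n2 := k v (v + b) b hb (by grind)
  have n3 := k v (v + c) c hc (by grind)
  have n4 := k v (v + d) d hd (by grind)
  have n5 := k v (v + (a + (b + (c + d)))) _ he (by grind)
  -- outer 5-cycle: 12 - 34 - 15 - 23 - 45 - 12
  have o1 := k (v + (a + b)) (v + (c + d)) _ he (by grind)
  have o2 := k (v + (c + d)) (v + (b + (c + d))) b hb (by grind)
  have o3 := k (v + (b + (c + d))) (v + (b + c)) d hd (by grind)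
  have o4 := k (v + (b + c)) (v + (a + (b + c))) a ha (by grind)
  have o5 := k (v + (a + (b + c))) (v + (a + b)) c hc (by grind)
  -- inner 5-cycle: 35 - 24 - 13 - 25 - 14 - 35
  have i1 := k (v + (a + (b + d))) (v + (b + d)) a ha (by grind)
  have i2 := k (v + (b + d)) (v + (a + c)) _ he (by grind)
  have i3 := k (v + (a + c)) (v + (a + (c + d))) d hd (by grind)
  have i4 := k (v + (a + (c + d))) (v + (a + d)) c hc (by grind)
  have i5 := k (v + (a + d)) (v + (a + (b + d))) b hb (by grind)
  omega

open Finset in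
theorem clebsch_coset {V : Type*} [AddCommGroup V] [Module (ZMod 2) V] [DecidableEq V]
    (h2 : ∀ x : V, x + x = 0) (A : Finset V)
    (hsf : ∀ x y, x ∈ A → y ∈ A → x + y ∉ A)
    (a b c d : V) (ha : a ∈ A) (hb : b ∈ A) (hc : c ∈ A) (hd : d ∈ A)
    (he : a + b + c + d ∈ A) (v : V) :
    (∑ q : ZMod 2 × ZMod 2 × ZMod 2 × ZMod 2,
      if v + (q.1 • a + (q.2.1 • b + (q.2.2.1 • c + q.2.2.2 • d))) ∈ A then 1 else 0) ≤ 5 := by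
  by_cases h : ∃ q : ZMod 2 × ZMod 2 × ZMod 2 × ZMod 2,
      v + (q.1 • a + (q.2.1 • b + (q.2.2.1 • c + q.2.2.2 • d))) ∈ A
  · obtain ⟨q0, hq0⟩ := h
    have := clebsch_point h2 A hsf a b c d ha hb hc hd he _ hq0
    rw [← Equiv.sum_comp (Equiv.addLeft q0)]
    refine le_of_eq_of_le (Finset.sum_congr rfl fun q _ => ?_) this
    have e : v + ((Equiv.addLeft q0 q).1 • a + ((Equiv.addLeft q0 q).2.1 • b +
        ((Equiv.addLeft q0 q).2.2.1 • c + (Equiv.addLeft q0 q).2.2.2 • d)))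
        = v + (q0.1 • a + (q0.2.1 • b + (q0.2.2.1 • c + q0.2.2.2 • d)))
          + (q.1 • a + (q.2.1 • b + (q.2.2.1 • c + q.2.2.2 • d))) := by
      simp only [Equiv.coe_addLeft, Prod.fst_add, Prod.snd_add, add_smul]
      abel
    rw [e]
  · push Not at h
    simp [h]

/-- `x` is a sum of `n` elements of `A`. -/
def WkSum {V : Type*} [AddCommGroup V] (A : Finset V) (n : ℕ) (x : V) : Prop :=
  ∃ l : List V, l.length = n ∧ (∀ a ∈ l, a ∈ A) ∧ l.sum = x

theorem WkSum.add {V : Type*} [AddCommGroup V] {A : Finset V} {n m : ℕ} {x y : V}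
    (h : WkSum A n x) (h' : WkSum A m y) : WkSum A (n + m) (x + y) := by
  obtain ⟨l, rfl, hl, rfl⟩ := h
  obtain ⟨l', rfl, hl', rfl⟩ := h'
  refine ⟨l ++ l', by simp, ?_, by simp⟩
  intro a ha
  rcases List.mem_append.1 ha with h | h
  exacts [hl a h, hl' a h]

theorem WkSum.one {V : Type*} [AddCommGroup V] {A : Finset V} {x : V} (h : x ∈ A) :
    WkSum A 1 x := ⟨[x], by simp, by simpa using h, by simp⟩

open Finset in
theorem sum_ind_translate {V : Type*} [AddCommGroup V] [Fintype V] [DecidableEq V]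
    (A : Finset V) (t : V) : (∑ v : V, if v + t ∈ A then 1 else 0) = #A := by
  refine (Equiv.sum_comp (Equiv.addRight t) (fun v => if v ∈ A then 1 else 0)).trans ?_
  simp

open Finset in
theorem no_odd {V : Type*} [AddCommGroup V] [Module (ZMod 2) V] [Fintype V] [DecidableEq V]
    (A : Finset V) (h0 : (0 : V) ∉ A) (hsf : ∀ x y, x ∈ A → y ∈ A → x + y ∉ A)
    (hcard : 5 * Fintype.card V < 16 * #A) : ¬ ∃ n, Odd n ∧ WkSum A n 0 := by
  classical
  have h2 : ∀ x : V, x + x = 0 := ZModModule.add_self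
  intro hex
  obtain ⟨hodd, hW⟩ := Nat.find_spec hex
  have hmin : ∀ n, Odd n → WkSum A n 0 → Nat.find hex ≤ n :=
    fun n h h' => Nat.find_min' hex ⟨h, h'⟩
  generalize Nat.find hex = m at *
  obtain ⟨l, hlen, hl, hsum⟩ := hW
  have hm1 : m ≠ 1 := by
    rintro rfl
    obtain ⟨a, rfl⟩ := List.length_eq_one_iff.1 hlen
    simp at hsum hl
    exact h0 (hsum ▸ hl)
  have hm3 : m ≠ 3 := by
    rintro rfl
    obtain ⟨a, b, c, rfl⟩ := List.length_eq_three.1 hlen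
    simp at hsum hl
    refine hsf a b hl.1 hl.2.1 ?_
    have : a + b = c := by grind
    exact this ▸ hl.2.2
  have hm5 : m ≠ 5 := by
    intro hm
    match l, (hlen.trans hm) with
    | [a, b, c, d, e], _ =>
      simp at hsum hl
      obtain ⟨ha, hb, hc, hd, he⟩ := hl
      have h' : a + b + c + d = e := by grind
      have he' : a + b + c + d ∈ A := h' ▸ he
      have hh : (∑ v : V, ∑ q : ZMod 2 × ZMod 2 × ZMod 2 × ZMod 2,
        if v + (q.1 • a + (q.2.1 • b + (q.2.2.1 • c + q.2.2.2 • d))) ∈ A then 1 else 0)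
          ≤ ∑ v : V, 5 :=
        Finset.sum_le_sum fun v _ => clebsch_coset h2 A hsf a b c d ha hb hc hd he' v
      rw [Finset.sum_comm] at hh
      simp only [sum_ind_translate, Finset.sum_const, Finset.card_univ, Fintype.card_prod,
        ZMod.card, smul_eq_mul] at hh
      omega
  have hm7 : 7 ≤ m := by
    obtain ⟨k, hk⟩ := hodd
    omega
  have hpt : ∀ v : V, (∑ i ∈ range m, if v + (l.take i).sum ∈ A then 1 else 0) ≤ 2 := by
    intro v
    rw [← Finset.card_filter]
    by_contra hcon
    push Not at hcon
    have arc : ∀ i j, i < j → j < m → v + (l.take i).sum ∈ A → v + (l.take j).sum ∈ A →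
        (Odd (j - i) → m ≤ j - i + 2) ∧ (Odd (m - j + i) → m ≤ m - j + i + 2) := by
      intro i j hij hj hi' hj'
      have w2 := (WkSum.one hi').add (WkSum.one hj')
      have w1 : WkSum A (j - i) ((l.take i).sum + (l.take j).sum) := by
        refine ⟨(l.drop i).take (j - i), by simp; omega, ?_, ?_⟩
        · intro a ha
          exact hl a (List.mem_of_mem_drop (List.mem_of_mem_take ha))
        · have : l.take j = l.take i ++ (l.drop i).take (j - i) := by
            rw [← List.take_add]; congr 1; omega
          rw [this, List.sum_append, ← add_assoc, h2, zero_add]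
      have w3 : WkSum A (m - j + i) ((l.take i).sum + (l.take j).sum) := by
        refine ⟨l.drop j ++ l.take i, by simp; omega, ?_, ?_⟩
        · intro a ha
          rcases List.mem_append.1 ha with h | h
          exacts [hl a (List.mem_of_mem_drop h), hl a (List.mem_of_mem_take h)]
        · have : (l.take j).sum + (l.drop j).sum = 0 := by
            rw [← List.sum_append, List.take_append_drop, hsum]
          rw [List.sum_append]
          have h5 := h2 (l.take j).sum
          clear * - this h5
          grind
      constructor
      · intro ho
        apply hmin _ (by rw [Nat.odd_iff] at ho ⊢; omega)
        convert w1.add w2 using 1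
        have h5 := h2 v
        have h6 := h2 (l.take i).sum
        have h7 := h2 (l.take j).sum
        clear * - h5 h6 h7
        grind
      · intro ho
        apply hmin _ (by rw [Nat.odd_iff] at ho ⊢; omega)
        convert w3.add w2 using 1
        have h5 := h2 v
        have h6 := h2 (l.take i).sum
        have h7 := h2 (l.take j).sum
        clear * - h5 h6 h7
        grind
    have h3 : ∃ i j k, i < j ∧ j < k ∧ k < m ∧ v + (l.take i).sum ∈ A ∧
        v + (l.take j).sum ∈ A ∧ v + (l.take k).sum ∈ A := by
      obtain ⟨x, hx, y, hy, z, hz, hxy, hxz, hyz⟩ := Finset.two_lt_card.1 hcon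
      simp only [mem_filter, mem_range] at hx hy hz
      rcases lt_or_gt_of_ne hxy with h | h <;> rcases lt_or_gt_of_ne hxz with h' | h' <;>
        rcases lt_or_gt_of_ne hyz with h'' | h''
      · exact ⟨x, y, z, h, h'', hz.1, hx.2, hy.2, hz.2⟩
      · exact ⟨x, z, y, h', h'', hy.1, hx.2, hz.2, hy.2⟩
      · omega
      · exact ⟨z, x, y, h', h, hy.1, hz.2, hx.2, hy.2⟩
      · exact ⟨y, x, z, h, h', hz.1, hy.2, hx.2, hz.2⟩
      · omega
      · exact ⟨y, z, x, h'', h', hx.1, hy.2, hz.2, hx.2⟩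
      · exact ⟨z, y, x, h'', h, hx.1, hz.2, hy.2, hx.2⟩
    obtain ⟨i, j, k, hij, hjk, hk, hi', hj', hk'⟩ := h3
    have a1 := (arc i j hij (by omega) hi' hj').1
    have a2 := (arc j k hjk hk hj' hk').1
    have a3 := (arc i k (by omega) hk hi' hk').2
    simp only [Nat.odd_iff] at *
    omega
  have hh : (∑ v : V, ∑ i ∈ range m, if v + (l.take i).sum ∈ A then 1 else 0) ≤ ∑ v : V, 2 :=
    Finset.sum_le_sum fun v _ => hpt v
  rw [Finset.sum_comm] at hh
  simp only [sum_ind_translate, Finset.sum_const, Finset.card_univ, card_range, smul_eq_mul] at hh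
  have : 7 * #A ≤ m * #A := Nat.mul_le_mul_right _ hm7
  omega

/-- A dense sum-free set avoids a hyperplane. -/
theorem exists_functional {V : Type*} [AddCommGroup V] [Module (ZMod 2) V] [Fintype V]
    [DecidableEq V]
    (A : Finset V) (h0 : (0 : V) ∉ A) (hsf : ∀ x y, x ∈ A → y ∈ A → x + y ∉ A)
    (hcard : 5 * Fintype.card V < 16 * A.card) :
    ∃ f : V →ₗ[ZMod 2] ZMod 2, ∀ a ∈ A, f a = 1 := by
  have hno := no_odd A h0 hsf hcard
  have z2 : ∀ c : ZMod 2, c = 0 ∨ c = 1 := by decide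
  let M : Submodule (ZMod 2) (V × ZMod 2) :=
    { carrier := {z | ∃ n : ℕ, WkSum A n z.1 ∧ (n : ZMod 2) = z.2}
      add_mem' := by
        rintro x y ⟨n, hn, hn'⟩ ⟨m, hm, hm'⟩
        exact ⟨n + m, hn.add hm, by simp [hn', hm']⟩
      zero_mem' := ⟨0, ⟨[], by simp, by simp, by simp⟩, by simp⟩
      smul_mem' := by
        intro c x hx
        rcases z2 c with rfl | rfl
        · rw [zero_smul]
          exact ⟨0, ⟨[], by simp, by simp, by simp⟩, by simp⟩
        · rw [one_smul]; exact hx }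
  have hM : ((0 : V), (1 : ZMod 2)) ∉ M := by
    rintro ⟨n, hn, hn'⟩
    exact hno ⟨n, (ZMod.natCast_eq_one_iff_odd).1 hn', hn⟩
  obtain ⟨g, hg, hgM⟩ := Submodule.exists_le_ker_of_notMem hM
  refine ⟨g.comp (LinearMap.inl (ZMod 2) V (ZMod 2)), fun a ha => ?_⟩
  have h1 : g (a, 1) = 0 := hgM (show (a, (1 : ZMod 2)) ∈ M from ⟨1, WkSum.one ha, by simp⟩)
  have h3 : g (a, 1) = g (a, 0) + g (0, 1) := by rw [← map_add]; simp
  have h4 : g (0, 1) = 1 := (z2 _).resolve_left hg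
  rw [h1, h4] at h3
  show g (a, 0) = 1
  generalize g (a, 0) = t at *
  revert t; decide

theorem no_fano {V : Type*} [AddCommGroup V] [Module (ZMod 2) V]
    (E : Set V) (h0 : (0 : V) ∉ E)
    (hfree : ¬ ∃ W : Submodule (ZMod 2) V,
      Module.finrank (ZMod 2) W = 3 ∧ ∀ x ∈ W, x ≠ 0 → x ∈ E)
    (x y z : V) (hx : x ∈ E) (hy : y ∈ E) (hz : z ∈ E) (hxy : x + y ∈ E) (hxz : x + z ∈ E)
    (hyz : y + z ∈ E) (hxyz : x + y + z ∈ E) : False := by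
  have z2 : ∀ c : ZMod 2, c = 0 ∨ c = 1 := by decide
  have hn : ∀ w ∈ E, w ≠ 0 := fun w hw h => h0 (h ▸ hw)
  have hli : LinearIndependent (ZMod 2) ![x, y, z] := by
    rw [Fintype.linearIndependent_iff]
    intro g hg
    simp only [Fin.sum_univ_three, Matrix.cons_val] at hg
    have : g 0 = 0 ∧ g 1 = 0 ∧ g 2 = 0 := by
      rcases z2 (g 0) with a | a <;> rcases z2 (g 1) with b | b <;> rcases z2 (g 2) with c | c <;>
        simp only [a, b, c, zero_smul, one_smul, add_zero, zero_add] at hg ⊢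
      · simp
      all_goals exact absurd hg (hn _ (by assumption))
    intro i
    fin_cases i
    exacts [this.1, this.2.1, this.2.2]
  apply hfree
  refine ⟨Submodule.span (ZMod 2) (Set.range ![x, y, z]), ?_, ?_⟩
  · simpa using finrank_span_eq_card hli
  · intro w hw hw0
    rw [Submodule.mem_span_range_iff_exists_fun] at hw
    obtain ⟨g, rfl⟩ := hw
    simp only [Fin.sum_univ_three, Matrix.cons_val] at hw0 ⊢
    rcases z2 (g 0) with a | a <;> rcases z2 (g 1) with b | b <;> rcases z2 (g 2) with c | c <;>
        simp only [a, b, c, zero_smul, one_smul, add_zero, zero_add] at hw0 ⊢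
    · exact absurd rfl hw0
    all_goals assumption

open Finset in
theorem stmt_17 (r : ℕ) (hr : 3 ≤ r)
    (E : Set (Fin r → ZMod 2)) (h0 : (0 : Fin r → ZMod 2) ∉ E)
    (hfree : ¬ ∃ W : Submodule (ZMod 2) (Fin r → ZMod 2),
      Module.finrank (ZMod 2) W = 3 ∧ ∀ x ∈ W, x ≠ 0 → x ∈ E)
    (hcard : (5/8 : ℝ) * 2^r < (E.ncard : ℝ))
    (htri : ∀ H : Submodule (ZMod 2) (Fin r → ZMod 2),
      Module.finrank (ZMod 2) H = r - 1 →
      ∃ x y, x ∈ E ∧ y ∈ E ∧ x + y ∈ E ∧ x ≠ y ∧ x ∈ H ∧ y ∈ H ∧ x + y ∈ H) :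
    ∀ p ∈ E, (({x ∈ E | x ≠ p ∧ x + p ∈ E}).ncard : ℝ) ≤ (5/16 : ℝ) * 2^r := by
  classical
  intro p hp
  by_contra hcon
  push Not at hcon
  have h2 : ∀ x : Fin r → ZMod 2, x + x = 0 := ZModModule.add_self
  have fano := no_fano E h0 hfree
  obtain ⟨F, rfl⟩ : ∃ F : Finset (Fin r → ZMod 2), (F : Set _) = E :=
    ⟨E.toFinite.toFinset, by simp⟩
  obtain ⟨A, hA⟩ : ∃ A : Finset (Fin r → ZMod 2),
    A = F.filter (fun x => x ≠ p ∧ x + p ∈ F) := ⟨_, rfl⟩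
  have hAm : ∀ x, x ∈ A ↔ x ∈ F ∧ x ≠ p ∧ x + p ∈ F := by
    intro x; rw [hA, mem_filter]
  have hAs : {x ∈ (F : Set (Fin r → ZMod 2)) | x ≠ p ∧ x + p ∈ (F : Set (Fin r → ZMod 2))}
      = (A : Set _) := by
    ext x; simp [hAm]
  rw [hAs] at hcon
  rw [Set.ncard_coe_finset] at hcon hcard
  simp only [mem_coe] at *
  have hV : Fintype.card (Fin r → ZMod 2) = 2 ^ r := by simp [ZMod.card]
  have hcA : 5 * Fintype.card (Fin r → ZMod 2) < 16 * #A := by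
    rw [hV]
    have : (5 : ℝ) * 2 ^ r < 16 * #A := by linarith
    exact_mod_cast this
  have hcF : 5 * 2 ^ r < 8 * #F := by
    have : (5 : ℝ) * 2 ^ r < 8 * #F := by linarith
    exact_mod_cast this
  have hA0 : (0 : Fin r → ZMod 2) ∉ A := fun h => h0 ((hAm 0).1 h).1
  have hsf : ∀ x y, x ∈ A → y ∈ A → x + y ∉ A := by
    intro x y hx hy hxy
    rw [hAm] at hx hy hxy
    refine fano x y p hx.1 hy.1 hp hxy.1 hx.2.2 hy.2.2 hxy.2.2
  obtain ⟨f, hf⟩ := exists_functional A hA0 hsf hcA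
  obtain ⟨a, ha⟩ : A.Nonempty := by
    rw [← Finset.card_pos]; omega
  have hfa := hf a ha
  have hap : a + p ∈ A := by
    have h := (hAm a).1 ha
    rw [hAm]
    refine ⟨h.2.2, fun h' => h0 ?_, ?_⟩
    · have : a = 0 := by simpa using h'
      exact this ▸ h.1
    · have : a + p + p = a := by rw [add_assoc, h2, add_zero]
      rw [this]; exact h.1
  have hfp : f p = 0 := by
    have := hf _ hap
    rw [map_add, hfa] at this
    simpa using this
  have hfr : Module.finrank (ZMod 2) (LinearMap.ker f) = r - 1 := by
    have h1 := LinearMap.finrank_range_add_finrank_ker f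
    have h3 : LinearMap.range f = ⊤ := by
      rw [LinearMap.range_eq_top]
      intro c
      exact ⟨c • a, by simp [hfa]⟩
    rw [h3] at h1
    simp at h1
    omega
  obtain ⟨x, y, hx, hy, hxy, -, hxH, hyH, -⟩ := htri _ hfr
  rw [LinearMap.mem_ker] at hxH hyH
  -- counting
  let H : Finset (Fin r → ZMod 2) := univ.filter (fun v => f v = 0)
  let K : Finset (Fin r → ZMod 2) := univ.filter (fun v => ¬ f v = 0)
  have z2 : ∀ c : ZMod 2, c ≠ 0 → c = 1 := by decide
  have hHK : #H + #K = 2 ^ r := by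
    rw [← hV, ← Finset.card_univ]
    exact Finset.card_filter_add_card_filter_not _
  have hKH : #K ≤ #H := by
    apply Finset.card_le_card_of_injOn (fun v => v + a)
    · intro v hv
      simp only [K, H, coe_filter, mem_univ, true_and, Set.mem_ofPred_eq] at hv ⊢
      rw [map_add, z2 _ hv, hfa]; decide
    · intro u _ v _ h
      simpa using h
  have hHK' : #H ≤ #K := by
    apply Finset.card_le_card_of_injOn (fun v => v + a)
    · intro v hv
      simp only [K, H, coe_filter, mem_univ, true_and, Set.mem_ofPred_eq] at hv ⊢
      rw [map_add, hv, hfa]; decide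
    · intro u _ v _ h
      simpa using h
  have hFsplit : #(F.filter (fun v => f v = 0)) + #(F.filter (fun v => ¬ f v = 0)) = #F :=
    Finset.card_filter_add_card_filter_not _
  have hF1 : 2 * #(F.filter (fun v => f v = 0)) ≤ #H := by
    have e1 : #(H.filter (fun v => v ∈ F)) + #(H.filter (fun v => ¬ v ∈ F)) = #H :=
      Finset.card_filter_add_card_filter_not _
    have e2 : H.filter (fun v => v ∈ F) = F.filter (fun v => f v = 0) := by
      ext v; simp [H, and_comm]
    have e3 : #(F.filter (fun v => f v = 0)) ≤ #(H.filter (fun v => ¬ v ∈ F)) := by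
      apply Finset.card_le_card_of_injOn (fun v => v + p)
      · intro v hv
        simp only [H, coe_filter, mem_filter, mem_univ, true_and, Set.mem_ofPred_eq] at hv ⊢
        refine ⟨by rw [map_add, hv.2, hfp, add_zero], fun h => ?_⟩
        by_cases hvp : v = p
        · rw [hvp, h2] at h; exact h0 h
        · have := hf v ((hAm v).2 ⟨hv.1, hvp, h⟩)
          rw [hv.2] at this
          exact absurd this (by decide)
      · intro u _ v _ h
        simpa using h
    rw [e2] at e1
    omega
  have hF2 : 4 * #(F.filter (fun v => ¬ f v = 0)) ≤ 3 * #K := by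
    set G := F.filter (fun v => ¬ f v = 0) with hG
    have hGm : ∀ t, f t = 0 → ∀ v, v + t ∈ G → (v + t ∈ F ∧ ¬ f v = 0) := by
      intro t ht v hv
      rw [hG, mem_filter, map_add, ht, add_zero] at hv
      exact hv
    have hpt : ∀ v, (if v + 0 ∈ G then 1 else 0) + (if v + x ∈ G then 1 else 0)
        + (if v + y ∈ G then 1 else 0) + (if v + (x + y) ∈ G then 1 else 0)
        ≤ if v ∈ K then 3 else 0 := by
      intro v
      by_cases hv : f v = 0
      · have q : ∀ t, f t = 0 → v + t ∉ G := fun t ht h => (hGm t ht v h).2 hv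
        rw [if_neg (q 0 (by simp)), if_neg (q x hxH), if_neg (q y hyH),
          if_neg (q (x + y) (by simp [hxH, hyH]))]
        simp
      · rw [if_pos (show v ∈ K by simp [K, hv])]
        by_contra hc
        have h1 : v + 0 ∈ G := by by_contra h; rw [if_neg h] at hc; split_ifs at hc <;> omega
        have h2 : v + x ∈ G := by by_contra h; rw [if_neg h] at hc; split_ifs at hc <;> omega
        have h3 : v + y ∈ G := by by_contra h; rw [if_neg h] at hc; split_ifs at hc <;> omega
        have h4 : v + (x + y) ∈ G := by
          by_contra h; rw [if_neg h] at hc; split_ifs at hc <;> omega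
        have g1 := (hGm 0 (by simp) v h1).1
        have g2 := (hGm x hxH v h2).1
        have g3 := (hGm y hyH v h3).1
        have g4 := (hGm (x + y) (by simp [hxH, hyH]) v h4).1
        rw [add_zero] at g1
        exact fano v x y g1 hx hy g2 g3 hxy (by rw [add_assoc]; exact g4)
    have hs := Finset.sum_le_sum (s := univ) fun v _ => hpt v
    simp only [Finset.sum_add_distrib, sum_ind_translate] at hs
    rw [← Finset.sum_filter] at hs
    simp only [Finset.sum_const, smul_eq_mul, Finset.filter_univ_mem] at hs
    omega
  omega
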